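/- arXiv:1606.00300 — 2 statements merged into one kernel-verified Lean document; each statement's English description precedes it below -/
import Mathlib

section
/- For q ≥ 4, the number of 𝔽_q-points of ℙ² not lying on the union of the conic through five points in general position and the ten lines through pairs of them equals (q − 5)². In particular, there exist 6 rational points in general position in ℙ²(𝔽_q) if and only if q ∉ {2, 3, 5}. -/
/-- Three points in `ℙ²(k)` are collinear: a nonzero linear form vanishes at all three. -/
def Collinear3 {k : Type*} [Field k] (a b c : Fin 3 → k) : Prop :=
  ∃ f : (Fin 3 → k) →ₗ[k] k, f ≠ 0 ∧ f a = 0 ∧ f b = 0 ∧ f c = 0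

/-- A plane curve is smooth over the algebraic closure. -/
def SmoothPlaneCurve {k : Type*} [Field k] (Q : MvPolynomial (Fin 3) k) : Prop :=
  ∀ v : Fin 3 → AlgebraicClosure k, v ≠ 0 → MvPolynomial.aeval v Q = 0 →
    ∃ i : Fin 3, MvPolynomial.aeval v (MvPolynomial.pderiv i Q) ≠ 0

/-- Rational points of `ℙ²` on one of the lines through pairs of the given points. -/
def linesThrough {F : Type*} [Field F] {n : ℕ} (P : Fin n → (Fin 3 → F)) :
    Set (Projectivization F (Fin 3 → F)) :=
  {p | ∃ i j, i ≠ j ∧ (Matrix.of ![p.rep, P i, P j]).det = 0}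

/-- Rational points of `ℙ²` on the conic `Q = 0`. -/
def conicPoints {F : Type*} [Field F] (Q : MvPolynomial (Fin 3) F) :
    Set (Projectivization F (Fin 3 → F)) :=
  {p | MvPolynomial.eval p.rep Q = 0}

namespace SixPts
variable {F : Type*} [Field F]

def Reg (x y : F) : Prop := x ≠ 0 ∧ y ≠ 0 ∧ x ≠ 1 ∧ y ≠ 1 ∧ x ≠ y

def Good (a b x y : F) : Prop := Reg x y ∧ x ≠ a ∧ y ≠ b ∧ x*b ≠ y*a ∧
  (x-1)*(b-1) ≠ (y-1)*(a-1) ∧ a*(b-1)*y + b*(1-a)*x + (a-b)*x*y ≠ 0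

theorem excl {a b x y : F} (h : Reg a b) (h' : Reg x y) (hn : x = a → y = b → False) :
   (x = a → x*b ≠ y*a ∧ (x-1)*(b-1) ≠ (y-1)*(a-1) ∧ a*(b-1)*y + b*(1-a)*x + (a-b)*x*y ≠ 0) ∧
   (y = b → x*b ≠ y*a ∧ (x-1)*(b-1) ≠ (y-1)*(a-1) ∧ a*(b-1)*y + b*(1-a)*x + (a-b)*x*y ≠ 0) ∧
   (x*b = y*a → (x-1)*(b-1) ≠ (y-1)*(a-1) ∧ a*(b-1)*y + b*(1-a)*x + (a-b)*x*y ≠ 0) ∧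
   ((x-1)*(b-1) = (y-1)*(a-1) → a*(b-1)*y + b*(1-a)*x + (a-b)*x*y ≠ 0) := by
  obtain ⟨h1, h2, h3, h4, h5⟩ := h
  obtain ⟨g1, g2, g3, g4, g5⟩ := h'
  have key : x*b = y*a → (x-1)*(b-1) ≠ (y-1)*(a-1) := by
    intro e e'
    grind
  refine ⟨fun e => ⟨?_, ?_, ?_⟩, fun e => ⟨?_, ?_, ?_⟩, fun e => ⟨key e, ?_⟩, fun e => ?_⟩ <;> intro e'
  · grind
  · grind
  · grind
  · grind
  · grind
  · grind
  · have : y * a * (a-b) * (y-b) = 0 := by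
      linear_combination b * e' - (b*(1-a)+(a-b)*y)*e
    have h6 : a - b ≠ 0 := sub_ne_zero.2 h5
    have h7 : y - b = 0 := by simpa [h1, g2, h6] using this
    have h8 : y = b := sub_eq_zero.1 h7
    subst h8
    exact hn (mul_right_cancel₀ h2 (by rw [e, mul_comm])) rfl
  · have : (y-1)*(a-1)*(x*b-y*a) = 0 := by
      linear_combination e' + y*a*e
    have h6 : a - 1 ≠ 0 := sub_ne_zero.2 h3
    have h7 : y - 1 ≠ 0 := sub_ne_zero.2 g4
    have h8 : x*b-y*a = 0 := by simpa [h6, h7] using this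
    exact key (sub_eq_zero.1 h8) e

open Classical in
noncomputable def ind (p : Prop) : ℤ := if p then 1 else 0

theorem ind_true {p : Prop} (h : p) : ind p = 1 := if_pos h
theorem ind_false {p : Prop} (h : ¬ p) : ind p = 0 := if_neg h

theorem ind_five (A B C D E : Prop) (hn : A → B → False) (q1 : A → ¬C ∧ ¬D ∧ ¬E)
    (q2 : B → ¬C ∧ ¬D ∧ ¬E) (q3 : C → ¬D ∧ ¬E) (q4 : D → ¬E) :
    ind (¬A ∧ ¬B ∧ ¬C ∧ ¬D ∧ ¬E) = 1 - ind A - ind B - ind C - ind D - ind E + 4 * 0 := by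
  unfold ind
  by_cases A <;> by_cases B <;> by_cases C <;> by_cases D <;> by_cases E <;> simp_all

open Classical in
theorem card_graph [Fintype F] (s : F) (h0 : s ≠ 0) (h1 : s ≠ 1) (g : F → F) (C : F → F → Prop)
    (hC : ∀ x y, C x y ↔ (x ≠ 0 ∧ x ≠ 1 ∧ x ≠ s) ∧ y = g x) :
    (∑ p : F × F, ind (C p.1 p.2)) = Fintype.card F - 3 := by
  have e : (Finset.univ.filter (fun p : F × F => C p.1 p.2)) =
      (({0, 1, s} : Finset F)ᶜ).image (fun t => (t, g t)) := by
    ext ⟨x, y⟩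
    simp only [hC, Finset.mem_filter, Finset.mem_univ, true_and, Finset.mem_image,
      Finset.mem_compl, Finset.mem_insert, Finset.mem_singleton, Prod.mk.injEq]
    grind
  have h3 : ({0, 1, s} : Finset F).card = 3 := by
    rw [Finset.card_eq_three]; exact ⟨0, 1, s, zero_ne_one, h0.symm, h1.symm, rfl⟩
  have h4 : ({0, 1, s} : Finset F).card ≤ Fintype.card F := Finset.card_le_univ _
  simp only [ind]
  rw [Finset.sum_boole, e, Finset.card_image_of_injective _ (fun t u h => (Prod.mk.inj h).1),
    Finset.card_compl, h3]
  push_cast [h3 ▸ h4]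
  ring

open Classical in
theorem card_reg [Fintype F] :
    (∑ p : F × F, ind (Reg p.1 p.2)) =
      (Fintype.card F - 2) * (Fintype.card F - 3) := by
  have e : (Finset.univ.filter (fun p : F × F => Reg p.1 p.2)) =
      (({0, 1} : Finset F)ᶜ).offDiag := by
    ext ⟨x, y⟩
    simp only [Reg, Finset.mem_filter, Finset.mem_univ, true_and, Finset.mem_offDiag,
      Finset.mem_compl, Finset.mem_insert, Finset.mem_singleton]
    grind
  have h2 : ({0, 1} : Finset F).card = 2 := by
    rw [Finset.card_eq_two]; exact ⟨0, 1, zero_ne_one, rfl⟩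
  have h4 : ({0, 1} : Finset F).card ≤ Fintype.card F := Finset.card_le_univ _
  rw [h2] at h4
  simp only [ind]
  rw [Finset.sum_boole, e, Finset.offDiag_card, Finset.card_compl, h2,
    Nat.cast_sub (Nat.le_mul_self _)]
  push_cast [h4]
  ring

open Classical in
theorem card_good [Fintype F] {a b : F} (h : Reg a b) :
    (Nat.card {p : F × F // Good a b p.1 p.2} : ℤ) = ((Fintype.card F : ℤ) - 5)^2 := by
  have hh := h
  obtain ⟨h1, h2, h3, h4, h5⟩ := hh
  have k3 : a - 1 ≠ 0 := sub_ne_zero.2 h3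
  have k4 : b - 1 ≠ 0 := sub_ne_zero.2 h4
  have k5 : b - a ≠ 0 := sub_ne_zero.2 h5.symm
  have c1 : (∑ p : F × F, ind (Reg p.1 p.2 ∧ p.1 = a)) = Fintype.card F - 3 := by
    rw [← card_graph a h1 h3 (fun _ => a) (fun y x => Reg x y ∧ x = a) (by
      intro y x; unfold Reg; grind)]
    exact Fintype.sum_equiv (Equiv.prodComm F F) _ _ (fun p => rfl)
  have c2 : (∑ p : F × F, ind (Reg p.1 p.2 ∧ p.2 = b)) = Fintype.card F - 3 := by
    exact card_graph b h2 h4 (fun _ => b) (fun x y => Reg x y ∧ y = b) (by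
      intro y x; unfold Reg; grind)
  have c3 : (∑ p : F × F, ind (Reg p.1 p.2 ∧ p.1*b = p.2*a)) =
      Fintype.card F - 3 := by
    refine card_graph (a/b) (by positivity) (by grind) (fun x => x*b/a)
      (fun x y => Reg x y ∧ x*b = y*a) ?_
    intro x y
    rw [eq_div_iff h1, ne_eq x, ne_eq x, ne_eq x, eq_div_iff h2]; unfold Reg
    constructor
    · grind
    · rintro ⟨⟨g1, g2, g3⟩, g4⟩
      refine ⟨⟨g1, ?_, g2, ?_, ?_⟩, g4.symm⟩ <;> grind
  have c4 : (∑ p : F × F, ind (Reg p.1 p.2 ∧ (p.1-1)*(b-1) = (p.2-1)*(a-1))) =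
      Fintype.card F - 3 := by
    refine card_graph ((b-a)/(b-1)) (by positivity) (by grind) (fun x => ((x-1)*(b-1)+(a-1))/(a-1))
      (fun x y => Reg x y ∧ (x-1)*(b-1) = (y-1)*(a-1)) ?_
    intro x y
    rw [eq_div_iff k3, ne_eq x, ne_eq x, ne_eq x, eq_div_iff k4]; unfold Reg
    constructor
    · rintro ⟨⟨g1, g2, g3, g4, g5⟩, g6⟩
      refine ⟨⟨g1, g3, ?_⟩, by linear_combination -g6⟩
      intro hx
      have : y*(a-1) = 0 := by linear_combination -g6 + hx
      simp [g2, k3] at this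
    · rintro ⟨⟨g1, g2, g3⟩, g4⟩
      refine ⟨⟨g1, ?_, g2, ?_, ?_⟩, ?_⟩ <;> grind
  have c5 : (∑ p : F × F, ind (Reg p.1 p.2 ∧
      a*(b-1)*p.2 + b*(1-a)*p.1 + (a-b)*p.1*p.2 = 0)) =
      Fintype.card F - 3 := by
    refine card_graph (a*(b-1)/(b-a)) (by positivity) (by grind)
      (fun x => b*(a-1)*x/(a*(b-1)+(a-b)*x))
      (fun x y => Reg x y ∧ a*(b-1)*y + b*(1-a)*x + (a-b)*x*y = 0) ?_
    intro x y
    rw [ne_eq x, ne_eq x, ne_eq x, eq_div_iff k5]; unfold Reg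
    constructor
    · rintro ⟨⟨g1, g2, g3, g4, g5⟩, g6⟩
      have : ¬ x*(b-a) = a*(b-1) := by
        intro hx
        have : b*(a-1)*x = 0 := by linear_combination -g6 - y*hx
        simp [h2, k3, g1] at this
      have h9 : a*(b-1)+(a-b)*x ≠ 0 := by intro hx; apply this; linear_combination -hx
      refine ⟨⟨g1, g3, this⟩, ?_⟩
      rw [eq_div_iff h9]; linear_combination g6
    · rintro ⟨⟨g1, g2, g3⟩, g4⟩
      have h9 : a*(b-1)+(a-b)*x ≠ 0 := by intro hx; apply g3; linear_combination -hx
      rw [eq_div_iff h9] at g4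
      have g2' : x - 1 ≠ 0 := sub_ne_zero.2 g2
      refine ⟨⟨g1, ?_, g2, ?_, ?_⟩, by linear_combination g4⟩
      · rintro rfl
        have : b*(a-1)*x = 0 := by linear_combination -g4
        simp [h2, k3, g1] at this
      · rintro rfl
        have : a*(b-1)*(x-1) = 0 := by linear_combination -g4
        simp [h1, k4, g2'] at this
      · rintro rfl
        have : x*(b-a)*(x-1) = 0 := by linear_combination -g4
        simp [g1, k5, g2'] at this
  have c6 : (∑ p : F × F, ind (p = (a, b))) = 1 := by
    rw [Finset.sum_eq_single (a, b) (fun p _ hp => ind_false hp) (by simp)]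
    exact ind_true rfl
  have c0 : (Nat.card {p : F × F // Good a b p.1 p.2} : ℤ) =
      ∑ p : F × F, ind (Good a b p.1 p.2) := by
    simp only [ind]
    rw [Finset.sum_boole, Nat.card_eq_fintype_card, Fintype.card_subtype]
  have main : ∀ p : F × F, (ind (Good a b p.1 p.2)) =
      (ind (Reg p.1 p.2))
      - (ind (Reg p.1 p.2 ∧ p.1 = a))
      - (ind (Reg p.1 p.2 ∧ p.2 = b))
      - (ind (Reg p.1 p.2 ∧ p.1*b = p.2*a))
      - (ind (Reg p.1 p.2 ∧ (p.1-1)*(b-1) = (p.2-1)*(a-1)))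
      - (ind (Reg p.1 p.2 ∧ a*(b-1)*p.2 + b*(1-a)*p.1 + (a-b)*p.1*p.2 = 0))
      + 4 * (ind (p = (a, b))) := by
    rintro ⟨x, y⟩
    by_cases hxy : (x, y) = (a, b)
    · obtain ⟨rfl, rfl⟩ := Prod.mk.inj hxy
      have e5 : x*(y-1)*y + y*(1-x)*x + (x-y)*x*y = 0 := by ring
      rw [ind_false (by simp [Good]), ind_true h, ind_true ⟨h, rfl⟩, ind_true ⟨h, rfl⟩,
        ind_true ⟨h, mul_comm _ _⟩, ind_true ⟨h, mul_comm _ _⟩, ind_true ⟨h, e5⟩, ind_true rfl]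
      norm_num
    · by_cases hr : Reg x y
      · have hn : x = a → y = b → False := fun h h' => hxy (by rw [h, h'])
        obtain ⟨q1, q2, q3, q4⟩ := excl h hr hn
        simp only [Good, hr, true_and, hxy]
        rw [ind_true trivial, ind_false id]
        exact ind_five _ _ _ _ _ hn q1 q2 q3 q4
      · simp [Good, hr, hxy, ind]
  rw [c0, Finset.sum_congr rfl (fun p _ => main p)]
  simp only [Finset.sum_add_distrib, Finset.sum_sub_distrib, ← Finset.mul_sum]
  rw [c1, c2, c3, c4, c5, c6, card_reg]
  ring

open MvPolynomial in
noncomputable def qp (c : Fin 6 → F) : MvPolynomial (Fin 3) F :=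
  C (c 0) * (X 0 * X 0) + C (c 1) * (X 1 * X 1) + C (c 2) * (X 2 * X 2) + C (c 3) * (X 1 * X 2)
    + C (c 4) * (X 0 * X 2) + C (c 5) * (X 0 * X 1)

def qf (c : Fin 6 → F) (v : Fin 3 → F) : F :=
  c 0 * (v 0 * v 0) + c 1 * (v 1 * v 1) + c 2 * (v 2 * v 2) + c 3 * (v 1 * v 2)
    + c 4 * (v 0 * v 2) + c 5 * (v 0 * v 1)

theorem eval_qp (c : Fin 6 → F) (v : Fin 3 → F) : MvPolynomial.eval v (qp c) = qf c v := by
  simp [qp, qf]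

theorem qp_hom (c : Fin 6 → F) : (qp c).IsHomogeneous 2 := by
  have h : ∀ (k : F) (i j : Fin 3), (MvPolynomial.C k * (MvPolynomial.X i * MvPolynomial.X j) :
      MvPolynomial (Fin 3) F).IsHomogeneous 2 := by
    intro k i j
    have := (MvPolynomial.isHomogeneous_C (Fin 3) k).mul
      ((MvPolynomial.isHomogeneous_X F i).mul (MvPolynomial.isHomogeneous_X F j))
    simpa using this
  unfold qp
  exact (((((h _ _ _).add (h _ _ _)).add (h _ _ _)).add (h _ _ _)).add (h _ _ _)).add (h _ _ _)

theorem exists_qp {Q : MvPolynomial (Fin 3) F} (hQ : Q.IsHomogeneous 2) : ∃ c, Q = qp c := by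
  have h : Q ∈ MvPolynomial.homogeneousSubmodule (Fin 3) F 2 := hQ
  rw [← MvPolynomial.homogeneousSubmodule_one_pow, pow_two,
    MvPolynomial.homogeneousSubmodule_one_eq_span_X, Submodule.span_mul_span] at h
  clear hQ
  induction h using Submodule.span_induction with
  | mem x hx =>
    obtain ⟨_, ⟨i, rfl⟩, _, ⟨j, rfl⟩, rfl⟩ := hx
    fin_cases i <;> fin_cases j
    · exact ⟨![1,0,0,0,0,0], by simp [qp]⟩
    · exact ⟨![0,0,0,0,0,1], by simp [qp]⟩
    · exact ⟨![0,0,0,0,1,0], by simp [qp]⟩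
    · exact ⟨![0,0,0,0,0,1], by simpa [qp] using mul_comm _ _⟩
    · exact ⟨![0,1,0,0,0,0], by simp [qp]⟩
    · exact ⟨![0,0,0,1,0,0], by simp [qp]⟩
    · exact ⟨![0,0,0,0,1,0], by simpa [qp] using mul_comm _ _⟩
    · exact ⟨![0,0,0,1,0,0], by simpa [qp] using mul_comm _ _⟩
    · exact ⟨![0,0,1,0,0,0], by simp [qp]⟩
  | zero => exact ⟨0, by simp [qp]⟩
  | add x y _ _ hx hy =>
    obtain ⟨c, rfl⟩ := hx
    obtain ⟨d, rfl⟩ := hy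
    exact ⟨c + d, by simp only [qp, Pi.add_apply, map_add]; ring⟩
  | smul a x _ hx =>
    obtain ⟨c, rfl⟩ := hx
    exact ⟨a • c, by simp only [qp, Pi.smul_apply, smul_eq_mul, map_mul, MvPolynomial.smul_eq_C_mul]; ring⟩

theorem qf_zero {c : Fin 6 → F} (h : ∀ v, qf c v = 0) : c = 0 := by
  have h0 := h ![1,0,0]
  have h1 := h ![0,1,0]
  have h2 := h ![0,0,1]
  have h3 := h ![0,1,1]
  have h4 := h ![1,0,1]
  have h5 := h ![1,1,0]
  simp [qf] at h0 h1 h2 h3 h4 h5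
  simp [h0, h1, h2] at h3 h4 h5
  funext i
  fin_cases i <;> simp [*]

theorem qp_ne_zero {c : Fin 6 → F} (h : c ≠ 0) : qp c ≠ 0 := by
  intro h0
  exact h (qf_zero fun v => by rw [← eval_qp, h0, map_zero])

theorem qf_smul (c : Fin 6 → F) (t : F) (v : Fin 3 → F) : qf c (t • v) = t ^ 2 * qf c v := by
  simp [qf]; ring

theorem exists_conic (P : Fin 5 → (Fin 3 → F)) : ∃ c : Fin 6 → F, c ≠ 0 ∧ ∀ i, qf c (P i) = 0 := by
  let A : Matrix (Fin 5) (Fin 6) F := fun i => ![P i 0 * P i 0, P i 1 * P i 1, P i 2 * P i 2,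
    P i 1 * P i 2, P i 0 * P i 2, P i 0 * P i 1]
  have hker : LinearMap.ker A.mulVecLin ≠ ⊥ := LinearMap.ker_ne_bot_of_finrank_lt (by simp)
  obtain ⟨c, hA, hc⟩ := (Submodule.ne_bot_iff _).1 hker
  rw [LinearMap.mem_ker, Matrix.mulVecLin_apply] at hA
  refine ⟨c, hc, fun i => ?_⟩
  have := congrFun hA i
  simp [A, Matrix.mulVec, dotProduct, Fin.sum_univ_six] at this
  unfold qf
  linear_combination this

theorem det3 (p q r : Fin 3 → F) : (Matrix.of ![p, q, r]).det =
    p 0 * q 1 * r 2 - p 0 * q 2 * r 1 - p 1 * q 0 * r 2 + p 1 * q 2 * r 0 + p 2 * q 0 * r 1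
      - p 2 * q 1 * r 0 := by
  simp [Matrix.det_fin_three]

theorem det_mulVec (M : Matrix (Fin 3) (Fin 3) F) (p q r : Fin 3 → F) :
    (Matrix.of ![M.mulVec p, M.mulVec q, M.mulVec r]).det = M.det * (Matrix.of ![p, q, r]).det := by
  rw [det3, det3, Matrix.det_fin_three]
  simp only [Matrix.mulVec, dotProduct, Fin.sum_univ_three]
  ring

theorem det_smul3 (s t u : F) (p q r : Fin 3 → F) :
    (Matrix.of ![s • p, t • q, u • r]).det = s * t * u * (Matrix.of ![p, q, r]).det := by
  rw [det3, det3]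
  simp only [Pi.smul_apply, smul_eq_mul]
  ring

theorem collinear_iff (p q r : Fin 3 → F) : Collinear3 p q r ↔ (Matrix.of ![p, q, r]).det = 0 := by
  rw [← Matrix.exists_mulVec_eq_zero_iff]
  constructor
  · rintro ⟨f, hf, h1, h2, h3⟩
    have key : ∀ v : Fin 3 → F, f v = v ⬝ᵥ (fun i => f (Pi.single i 1)) := by
      intro v
      conv_lhs => rw [pi_eq_sum_univ' v]
      simp [dotProduct, map_sum]
    refine ⟨fun i => f (Pi.single i 1), ?_, ?_⟩
    · intro h
      apply hf
      ext v
      simpa using congrFun h v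
    · rw [key] at h1 h2 h3
      funext i
      fin_cases i
      · exact h1
      · exact h2
      · exact h3
  · rintro ⟨v, hv, h⟩
    refine ⟨(LinearMap.mk₂ F (fun x y : Fin 3 → F => x ⬝ᵥ y) (by simp) (by simp) (by simp) (by simp)).flip v,
      ?_, ?_, ?_, ?_⟩
    · intro h0
      apply hv
      funext i
      have := LinearMap.congr_fun h0 (Pi.single i 1)
      simpa using this
    · exact congrFun h 0
    · exact congrFun h 1
    · exact congrFun h 2

def E (a b : F) : Fin 5 → (Fin 3 → F) := ![![1,0,0], ![0,1,0], ![0,0,1], ![1,1,1], ![a,b,1]]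

theorem exists_normal (P : Fin 5 → (Fin 3 → F))
    (hP : ∀ i j l : Fin 5, i ≠ j → i ≠ l → j ≠ l → (Matrix.of ![P i, P j, P l]).det ≠ 0) :
    ∃ (M : Matrix (Fin 3) (Fin 3) F) (s : Fin 5 → F) (a b : F), M.det ≠ 0 ∧ (∀ i, s i ≠ 0) ∧
      Reg a b ∧ ∀ i, P i = s i • M.mulVec (E a b i) := by
  have key : ∀ M : Matrix (Fin 3) (Fin 3) F, M.det ≠ 0 → ∀ v, ∃ w, v = M.mulVec w := by
    intro M hM v
    exact ⟨M⁻¹.mulVec v, by rw [Matrix.mulVec_mulVec, Matrix.mul_nonsing_inv _ (isUnit_iff_ne_zero.2 hM),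
      Matrix.one_mulVec]⟩
  let N : Matrix (Fin 3) (Fin 3) F := (Matrix.of ![P 0, P 1, P 2]).transpose
  have hN : N.det ≠ 0 := by
    rw [Matrix.det_transpose]; exact hP 0 1 2 (by decide) (by decide) (by decide)
  have n0 : P 0 = N.mulVec ![1,0,0] := by
    ext i; simp [N, Matrix.mulVec, dotProduct, Fin.sum_univ_three]
  have n1 : P 1 = N.mulVec ![0,1,0] := by
    ext i; simp [N, Matrix.mulVec, dotProduct, Fin.sum_univ_three]
  have n2 : P 2 = N.mulVec ![0,0,1] := by
    ext i; simp [N, Matrix.mulVec, dotProduct, Fin.sum_univ_three]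
  obtain ⟨α, hα⟩ := key N hN (P 3)
  have a0 : α 0 ≠ 0 := by
    have := hP 3 1 2 (by decide) (by decide) (by decide)
    rw [hα, n1, n2, det_mulVec, det3] at this
    simpa using right_ne_zero_of_mul this
  have a1 : α 1 ≠ 0 := by
    have := hP 3 0 2 (by decide) (by decide) (by decide)
    rw [hα, n0, n2, det_mulVec, det3] at this
    simpa using right_ne_zero_of_mul this
  have a2 : α 2 ≠ 0 := by
    have := hP 3 0 1 (by decide) (by decide) (by decide)
    rw [hα, n0, n1, det_mulVec, det3] at this
    simpa using right_ne_zero_of_mul this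
  let M := N * Matrix.diagonal α
  have hM : M.det ≠ 0 := by
    rw [Matrix.det_mul, Matrix.det_diagonal, Fin.prod_univ_three]
    positivity
  have m0 : P 0 = (α 0)⁻¹ • M.mulVec ![1,0,0] := by
    rw [n0, ← Matrix.mulVec_mulVec, ← Matrix.mulVec_smul]; congr 1
    ext i; fin_cases i <;> simp [a0, Matrix.mulVec_diagonal]
  have m1 : P 1 = (α 1)⁻¹ • M.mulVec ![0,1,0] := by
    rw [n1, ← Matrix.mulVec_mulVec, ← Matrix.mulVec_smul]; congr 1
    ext i; fin_cases i <;> simp [a1, Matrix.mulVec_diagonal]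
  have m2 : P 2 = (α 2)⁻¹ • M.mulVec ![0,0,1] := by
    rw [n2, ← Matrix.mulVec_mulVec, ← Matrix.mulVec_smul]; congr 1
    ext i; fin_cases i <;> simp [a2, Matrix.mulVec_diagonal]
  have m3 : P 3 = (1:F) • M.mulVec ![1,1,1] := by
    rw [hα, ← Matrix.mulVec_mulVec, ← Matrix.mulVec_smul]; congr 1
    ext i; fin_cases i <;> simp [Matrix.mulVec_diagonal]
  obtain ⟨β, hβ⟩ := key M hM (P 4)
  have m4 : P 4 = (1:F) • M.mulVec β := by rw [one_smul, hβ]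
  have b0 : β 0 ≠ 0 := by
    have := hP 4 1 2 (by decide) (by decide) (by decide)
    rw [m4, m1, m2, det_smul3, det_mulVec, det3] at this
    simpa using right_ne_zero_of_mul (right_ne_zero_of_mul this)
  have b1 : β 1 ≠ 0 := by
    have := hP 4 0 2 (by decide) (by decide) (by decide)
    rw [m4, m0, m2, det_smul3, det_mulVec, det3] at this
    simpa using right_ne_zero_of_mul (right_ne_zero_of_mul this)
  have b2 : β 2 ≠ 0 := by
    have := hP 4 0 1 (by decide) (by decide) (by decide)
    rw [m4, m0, m1, det_smul3, det_mulVec, det3] at this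
    simpa using right_ne_zero_of_mul (right_ne_zero_of_mul this)
  have b3 : β 0 ≠ β 2 := by
    have := hP 4 1 3 (by decide) (by decide) (by decide)
    rw [m4, m1, m3, det_smul3, det_mulVec, det3] at this
    have := right_ne_zero_of_mul (right_ne_zero_of_mul this)
    intro h; apply this; simp [h]
  have b4 : β 1 ≠ β 2 := by
    have := hP 4 0 3 (by decide) (by decide) (by decide)
    rw [m4, m0, m3, det_smul3, det_mulVec, det3] at this
    have := right_ne_zero_of_mul (right_ne_zero_of_mul this)
    intro h; apply this; simp [h]
  have b5 : β 0 ≠ β 1 := by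
    have := hP 4 2 3 (by decide) (by decide) (by decide)
    rw [m4, m2, m3, det_smul3, det_mulVec, det3] at this
    have := right_ne_zero_of_mul (right_ne_zero_of_mul this)
    intro h; apply this; simp [h]
  refine ⟨M, ![(α 0)⁻¹, (α 1)⁻¹, (α 2)⁻¹, 1, β 2], β 0 / β 2, β 1 / β 2, hM, ?_, ?_, ?_⟩
  · intro i; fin_cases i <;> simp [a0, a1, a2, b2]
  · refine ⟨by positivity, by positivity, ?_, ?_, ?_⟩
    · rw [ne_eq, div_eq_one_iff_eq b2]; exact b3
    · rw [ne_eq, div_eq_one_iff_eq b2]; exact b4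
    · rw [ne_eq, div_left_inj' b2]; exact b5
  · intro i
    fin_cases i
    · exact m0
    · exact m1
    · exact m2
    · exact m3
    · simp only [E]
      change P 4 = β 2 • M.mulVec ![β 0 / β 2, β 1 / β 2, 1]
      rw [hβ, ← Matrix.mulVec_smul]; congr 1
      ext i; fin_cases i <;> simp [b2] <;> field_simp

theorem conic_form {M : Matrix (Fin 3) (Fin 3) F} {a b : F} (hM : M.det ≠ 0) (h : Reg a b)
    {c : Fin 6 → F} (hc : c ≠ 0) (hE : ∀ i, qf c (M.mulVec (E a b i)) = 0) :
    ∃ k : F, k ≠ 0 ∧ ∀ x y, qf c (M.mulVec ![x, y, 1]) =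
      k * (a*(b-1)*y + b*(1-a)*x + (a-b)*x*y) := by
  obtain ⟨h1, h2, h3, h4, h5⟩ := h
  have k5 : a - b ≠ 0 := sub_ne_zero.2 h5
  obtain ⟨d, hd⟩ : ∃ d : Fin 6 → F, ∀ p, qf c (M.mulVec p) = qf d p := by
    let pol : (Fin 3 → F) → (Fin 3 → F) → F := fun u v => qf c (u + v) - qf c u - qf c v
    refine ⟨![qf c (M.col 0), qf c (M.col 1), qf c (M.col 2), pol (M.col 1) (M.col 2),
      pol (M.col 0) (M.col 2), pol (M.col 0) (M.col 1)], fun p => ?_⟩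
    simp [pol, qf, Matrix.mulVec, dotProduct, Fin.sum_univ_three]
    ring
  have e0 := hE 0
  have e1 := hE 1
  have e2 := hE 2
  have e3 := hE 3
  have e4 := hE 4
  rw [hd] at e0 e1 e2 e3 e4
  simp [qf, E] at e0 e1 e2 e3 e4
  simp [e0, e1, e2] at e3 e4
  have hk : d 5 = d 5 / (a - b) * (a - b) := by field_simp
  generalize d 5 / (a-b) = k at hk
  have hA : d 3 = k * (a*(b-1)) := by
    apply mul_right_cancel₀ k5
    linear_combination a * e3 - e4 + (a * b - a) * hk
  have hB : d 4 = k * (b*(1-a)) := by linear_combination e3 - hA - hk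
  refine ⟨k, ?_, ?_⟩
  · rintro rfl
    apply hc
    apply qf_zero
    intro v
    have : v = M.mulVec (M⁻¹.mulVec v) := by
      rw [Matrix.mulVec_mulVec, Matrix.mul_nonsing_inv _ (isUnit_iff_ne_zero.2 hM), Matrix.one_mulVec]
    rw [this, hd]
    simp [qf, e0, e1, e2, hA, hB, hk]
  · intro x y
    rw [hd]
    simp [qf, e0, e1, e2]
    linear_combination y * hA + x * hB + x * y * hk

theorem lines_iff {a b : F} (h : Reg a b) (x y : F) :
    (∀ i j, i ≠ j → (Matrix.of ![![x, y, 1], E a b i, E a b j]).det ≠ 0) ↔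
    (Reg x y ∧ x ≠ a ∧ y ≠ b ∧ x*b ≠ y*a ∧ (x-1)*(b-1) ≠ (y-1)*(a-1)) := by
  obtain ⟨h1, h2, h3, h4, h5⟩ := h
  simp only [det3]
  constructor
  · intro h
    have f12 := h 1 2 (by decide)
    have f02 := h 0 2 (by decide)
    have f13 := h 1 3 (by decide)
    have f03 := h 0 3 (by decide)
    have f23 := h 2 3 (by decide)
    have f14 := h 1 4 (by decide)
    have f04 := h 0 4 (by decide)
    have f24 := h 2 4 (by decide)
    have f34 := h 3 4 (by decide)
    simp [E] at f12 f02 f13 f03 f23 f14 f04 f24 f34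
    unfold Reg
    refine ⟨⟨?_, ?_, ?_, ?_, ?_⟩, ?_, ?_, ?_, ?_⟩
    all_goals grind
  · rintro ⟨⟨g1, g2, g3, g4, g5⟩, g6, g7, g8, g9⟩ i j hij
    fin_cases i <;> fin_cases j <;> first | exact absurd rfl hij | (simp [E]; try grind)

theorem good_iff {M : Matrix (Fin 3) (Fin 3) F} {a b : F} (hM : M.det ≠ 0) (h : Reg a b)
    {s : Fin 5 → F} (hs : ∀ i, s i ≠ 0)
    {P : Fin 5 → (Fin 3 → F)} (hP : ∀ i, P i = s i • M.mulVec (E a b i))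
    {c : Fin 6 → F} (hc : c ≠ 0) (hE : ∀ i, qf c (P i) = 0) {t : F} (ht : t ≠ 0) (x y : F) :
    (qf c (t • M.mulVec ![x, y, 1]) ≠ 0 ∧
      ∀ i j, i ≠ j → (Matrix.of ![t • M.mulVec ![x, y, 1], P i, P j]).det ≠ 0) ↔ Good a b x y := by
  have hE' : ∀ i, qf c (M.mulVec (E a b i)) = 0 := by
    intro i
    have := hE i
    rw [hP, qf_smul] at this
    simpa [hs i] using this
  obtain ⟨k, hk, hq⟩ := conic_form hM h hc hE'
  have hl : (∀ i j, i ≠ j → (Matrix.of ![t • M.mulVec ![x, y, 1], P i, P j]).det ≠ 0) ↔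
      (∀ i j, i ≠ j → (Matrix.of ![![x, y, 1], E a b i, E a b j]).det ≠ 0) := by
    refine forall_congr' fun i => forall_congr' fun j => forall_congr' fun _ => ?_
    rw [hP, hP, det_smul3, det_mulVec]
    simp [ht, hs, hM]
  rw [hl, lines_iff h, qf_smul, hq, Good]
  simp only [ne_eq, mul_eq_zero, hk, ht, pow_eq_zero_iff, OfNat.ofNat_ne_zero,
    not_false_eq_true, false_or]
  tauto

theorem card_compl [Fintype F] (P : Fin 5 → (Fin 3 → F))
    (hP : ∀ i j l : Fin 5, i ≠ j → i ≠ l → j ≠ l → (Matrix.of ![P i, P j, P l]).det ≠ 0)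
    {c : Fin 6 → F} (hc : c ≠ 0) (hE : ∀ i, qf c (P i) = 0) :
    (Nat.card {p : Projectivization F (Fin 3 → F) //
          p ∉ conicPoints (qp c) ∪ linesThrough P} : ℤ) = ((Fintype.card F : ℤ) - 5)^2 := by
  obtain ⟨M, s, a, b, hM, hs, h, hPE⟩ := exists_normal P hP
  have hmem : ∀ p : Projectivization F (Fin 3 → F), p ∉ conicPoints (qp c) ∪ linesThrough P ↔
      (qf c p.rep ≠ 0 ∧ ∀ i j, i ≠ j → (Matrix.of ![p.rep, P i, P j]).det ≠ 0) := by
    intro p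
    simp [conicPoints, linesThrough, eval_qp]
  have hinj : ∀ v w, M.mulVec v = M.mulVec w → v = w := fun v w hvw =>
    Matrix.mulVec_injective_iff_isUnit.2 ((Matrix.isUnit_iff_isUnit_det _).2 (isUnit_iff_ne_zero.2 hM)) hvw
  have hne : ∀ x y : F, M.mulVec ![x, y, 1] ≠ 0 := by
    intro x y h0
    have := hinj ![x, y, 1] 0 (by rw [h0, Matrix.mulVec_zero])
    simpa using congrFun this 2
  rw [← card_good h]
  congr 1
  symm
  refine Nat.card_congr (Equiv.ofBijective
    (fun p => ⟨Projectivization.mk F (M.mulVec ![p.1.1, p.1.2, 1]) (hne _ _), ?_⟩) ⟨?_, ?_⟩)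
  · obtain ⟨t, ht⟩ := Projectivization.exists_smul_eq_mk_rep F _ (hne p.1.1 p.1.2)
    rw [hmem, ← ht]
    exact (good_iff hM h hs hPE hc hE t.ne_zero _ _).2 p.2
  · rintro ⟨⟨x, y⟩, hp⟩ ⟨⟨x', y'⟩, hp'⟩ e
    have e := congrArg Subtype.val e
    dsimp only at e
    rw [Projectivization.mk_eq_mk_iff'] at e
    obtain ⟨t, ht⟩ := e
    rw [← Matrix.mulVec_smul] at ht
    have := hinj _ _ ht
    have e2 := congrFun this 2
    have e0 := congrFun this 0
    have e1 := congrFun this 1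
    simp at e0 e1 e2
    subst e2
    simp at e0 e1
    simp [e0, e1]
  · rintro ⟨p, hp⟩
    rw [hmem] at hp
    have hw : p.rep = M.mulVec (M⁻¹.mulVec p.rep) := by
      rw [Matrix.mulVec_mulVec, Matrix.mul_nonsing_inv _ (isUnit_iff_ne_zero.2 hM), Matrix.one_mulVec]
    generalize M⁻¹.mulVec p.rep = w at hw
    have w2 : w 2 ≠ 0 := by
      have := hp.2 0 1 (by decide)
      rw [hw, hPE, hPE, ← one_smul F (M.mulVec w), det_smul3, det_mulVec, det3] at this
      have := right_ne_zero_of_mul (right_ne_zero_of_mul this)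
      simpa [E] using this
    have hw' : p.rep = w 2 • M.mulVec ![w 0 / w 2, w 1 / w 2, 1] := by
      rw [hw, ← Matrix.mulVec_smul]; congr 1
      ext i; fin_cases i <;> simp <;> field_simp
    rw [hw'] at hp
    refine ⟨⟨(w 0 / w 2, w 1 / w 2), (good_iff hM h hs hPE hc hE w2 _ _).1 hp⟩, ?_⟩
    apply Subtype.ext
    dsimp only
    conv_rhs => rw [← Projectivization.mk_rep p]
    rw [Projectivization.mk_eq_mk_iff']
    exact ⟨(w 2)⁻¹, by rw [hw', smul_smul, inv_mul_cancel₀ w2, one_smul]⟩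

theorem exists_reg [Fintype F] (h4 : 4 ≤ Fintype.card F) : ∃ a b : F, Reg a b := by
  classical
  have : 1 < (({0, 1} : Finset F)ᶜ).card := by
    rw [Finset.card_compl]
    have := Finset.card_le_two (a := (0:F)) (b := 1)
    omega
  obtain ⟨a, ha, b, hb, hab⟩ := Finset.one_lt_card.1 this
  simp at ha hb
  exact ⟨a, b, ha.1, hb.1, ha.2, hb.2, hab⟩

theorem four_le [Fintype F] {a b : F} (h : Reg a b) : 4 ≤ Fintype.card F := by
  classical
  obtain ⟨h1, h2, h3, h4, h5⟩ := h
  have : ({0, 1, a, b} : Finset F).card = 4 := by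
    rw [Finset.card_insert_of_notMem, Finset.card_insert_of_notMem, Finset.card_pair h5] <;> simp <;> tauto
  rw [← this]; exact Finset.card_le_univ _

theorem exists_six [Fintype F] (h4 : 4 ≤ Fintype.card F) (h5 : Fintype.card F ≠ 5) :
    ∃ P : Fin 6 → (Fin 3 → F),
      (∀ i j l : Fin 6, i ≠ j → i ≠ l → j ≠ l → (Matrix.of ![P i, P j, P l]).det ≠ 0) ∧
      ∀ c : Fin 6 → F, c ≠ 0 → ¬ ∀ i, qf c (P i) = 0 := by
  obtain ⟨a, b, h⟩ := exists_reg h4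
  have hcard := card_good h
  have hpos : Nat.card {p : F × F // Good a b p.1 p.2} ≠ 0 := by
    intro h0
    rw [h0] at hcard
    have : ((Fintype.card F : ℤ) - 5) = 0 := by
      apply pow_eq_zero_iff (two_ne_zero) |>.1; rw [← hcard]; simp
    omega
  obtain ⟨⟨⟨x, y⟩, hg⟩⟩ := (Nat.card_ne_zero.1 hpos).1
  dsimp only at hg
  refine ⟨![![1,0,0], ![0,1,0], ![0,0,1], ![1,1,1], ![a,b,1], ![x,y,1]], ?_, ?_⟩
  · obtain ⟨⟨g1, g2, g3, g4, g5⟩, g6, g7, g8, g9, -⟩ := hg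
    obtain ⟨h1, h2, h3, h4, h5⟩ := h
    have key : ∀ i j l : Fin 6, i < j → j < l →
        (Matrix.of ![(![![1,0,0], ![0,1,0], ![0,0,1], ![1,1,1], ![a,b,1], ![x,y,1]] : Fin 6 → Fin 3 → F) i,
        (![![1,0,0], ![0,1,0], ![0,0,1], ![1,1,1], ![a,b,1], ![x,y,1]] : Fin 6 → Fin 3 → F) j,
        (![![1,0,0], ![0,1,0], ![0,0,1], ![1,1,1], ![a,b,1], ![x,y,1]] : Fin 6 → Fin 3 → F) l]).det ≠ 0 := by
      intro i j l hij hjl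
      rw [det3]
      fin_cases i <;> fin_cases j <;> first | exact absurd hij (by decide) | skip
      all_goals fin_cases l <;> first | exact absurd hjl (by decide) | (simp; try grind)
    generalize (![![1,0,0], ![0,1,0], ![0,0,1], ![1,1,1], ![a,b,1], ![x,y,1]] :
      Fin 6 → Fin 3 → F) = P at key
    simp only [det3] at key ⊢
    intro i j l hij hil hjl h0
    rcases lt_or_gt_of_ne hij with u | u <;> rcases lt_or_gt_of_ne hil with v | v <;>
      rcases lt_or_gt_of_ne hjl with w | w
    · exact key _ _ _ u w (by linear_combination h0)
    · exact key _ _ _ v w (by linear_combination -h0)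
    · exact absurd (u.trans w) (by simpa using v.le)
    · exact key _ _ _ v u (by linear_combination h0)
    · exact key _ _ _ u v (by linear_combination -h0)
    · exact absurd (w.trans u) (by simpa using v.le)
    · exact key _ _ _ w v (by linear_combination h0)
    · exact key _ _ _ w u (by linear_combination -h0)
  · intro c hc hall
    have := (good_iff (M := 1) (s := 1) (P := E a b) (by simp) h (by simp) (by simp) hc (by
      intro i
      have h0 := hall i.castSucc
      fin_cases i <;> exact h0) one_ne_zero x y).2 hg
    apply this.1
    simpa using hall 5

end SixPts

/-- For `q ≥ 4`, the number of `𝔽_q`-points of `ℙ²` not lying on the union of the conic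
through five points in general position and the ten lines through pairs of them equals
`(q − 5)²`.  In particular, there exist `6` rational points of `ℙ²(𝔽_q)` in general
position (pairwise distinct, no three collinear, no six on a conic) if and only if
`q ∉ {2, 3, 5}`. -/
theorem card_complement_and_exists_six_points {F : Type*} [Field F] [Fintype F] :
    (∀ (P : Fin 5 → (Fin 3 → F)) (Q : MvPolynomial (Fin 3) F),
      4 ≤ Fintype.card F →
      (∀ i, P i ≠ 0) →
      (∀ i j, i ≠ j → ∀ c : F, c • P i ≠ P j) →
      (∀ i j l : Fin 5, i ≠ j → i ≠ l → j ≠ l → ¬ Collinear3 (P i) (P j) (P l)) →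
      Q.IsHomogeneous 2 → Q ≠ 0 → SmoothPlaneCurve Q →
      (∀ i, MvPolynomial.eval (P i) Q = 0) →
      (Nat.card {p : Projectivization F (Fin 3 → F) //
          p ∉ conicPoints Q ∪ linesThrough P} : ℤ) = ((Fintype.card F : ℤ) - 5)^2) ∧
    ((∃ P : Fin 6 → (Fin 3 → F),
        (∀ i, P i ≠ 0) ∧
        (∀ i j, i ≠ j → ∀ c : F, c • P i ≠ P j) ∧
        (∀ i j l : Fin 6, i ≠ j → i ≠ l → j ≠ l → ¬ Collinear3 (P i) (P j) (P l)) ∧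
        ¬ ∃ Q : MvPolynomial (Fin 3) F, Q.IsHomogeneous 2 ∧ Q ≠ 0 ∧
            ∀ i, MvPolynomial.eval (P i) Q = 0) ↔
      (Fintype.card F ≠ 2 ∧ Fintype.card F ≠ 3 ∧ Fintype.card F ≠ 5)) := by
  constructor
  · intro P Q _ _ _ hcol hQ hQ0 _ hPQ
    obtain ⟨c, rfl⟩ := SixPts.exists_qp hQ
    refine SixPts.card_compl P ?_ ?_ ?_
    · intro i j l hij hil hjl h0
      exact hcol i j l hij hil hjl ((SixPts.collinear_iff _ _ _).2 h0)
    · rintro rfl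
      exact hQ0 (by simp [SixPts.qp])
    · intro i
      rw [← SixPts.eval_qp]
      exact hPQ i
  constructor
  · rintro ⟨P, hne, -, hcol, hconic⟩
    let P' : Fin 5 → (Fin 3 → F) := fun i => P i.castSucc
    have hP' : ∀ i j l : Fin 5, i ≠ j → i ≠ l → j ≠ l →
        (Matrix.of ![P' i, P' j, P' l]).det ≠ 0 := by
      intro i j l hij hil hjl h0
      exact hcol i.castSucc j.castSucc l.castSucc (by simpa using hij) (by simpa using hil)
        (by simpa using hjl) ((SixPts.collinear_iff _ _ _).2 h0)
    obtain ⟨M, s, a, b, -, -, h, -⟩ := SixPts.exists_normal P' hP'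
    have h4 := SixPts.four_le h
    refine ⟨by omega, by omega, fun h5 => ?_⟩
    obtain ⟨c, hc, hcP⟩ := SixPts.exists_conic P'
    have hcard := SixPts.card_compl P' hP' hc hcP
    rw [h5] at hcard
    have hcard0 : Nat.card {p : Projectivization F (Fin 3 → F) //
          p ∉ conicPoints (SixPts.qp c) ∪ linesThrough P'} = 0 := by
      have : (((5:ℕ):ℤ) - 5)^2 = 0 := by norm_num
      rw [this] at hcard
      exact_mod_cast hcard
    have : Finite (Projectivization F (Fin 3 → F)) := inferInstance
    rw [Nat.card_eq_zero] at hcard0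
    rcases hcard0 with hemp | hinf
    · obtain ⟨t, ht⟩ := Projectivization.exists_smul_eq_mk_rep F (P 5) (hne 5)
      refine hemp.false ⟨Projectivization.mk F (P 5) (hne 5), ?_⟩
      rintro (h1 | ⟨i, j, hij, h1⟩)
      · apply hconic
        refine ⟨SixPts.qp c, SixPts.qp_hom c, SixPts.qp_ne_zero hc, ?_⟩
        intro i
        rw [SixPts.eval_qp]
        induction i using Fin.lastCases with
        | cast i => exact hcP i
        | last =>
          change MvPolynomial.eval _ _ = 0 at h1
          rw [SixPts.eval_qp, ← ht, Units.smul_def, SixPts.qf_smul] at h1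
          simpa using h1
      · rw [← ht, Units.smul_def, ← one_smul F (P' i), ← one_smul F (P' j),
          SixPts.det_smul3] at h1
        have h2 : (Matrix.of ![P 5, P' i, P' j]).det = 0 := by simpa using h1
        exact hcol 5 i.castSucc j.castSucc (Fin.castSucc_lt_last i).ne' (Fin.castSucc_lt_last j).ne'
          (by simpa using hij) ((SixPts.collinear_iff _ _ _).2 h2)
    · exact hinf.not_finite inferInstance
  · rintro ⟨h2, h3, h5⟩
    have h1 : 1 < Fintype.card F := Fintype.one_lt_card
    obtain ⟨P, hP, hc⟩ := SixPts.exists_six (F := F) (by omega) h5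
    have third : ∀ i j : Fin 6, ∃ l, i ≠ l ∧ j ≠ l := by decide
    have second : ∀ i : Fin 6, ∃ j, i ≠ j := by decide
    refine ⟨P, ?_, ?_, ?_, ?_⟩
    · intro i h0
      obtain ⟨j, hj⟩ := second i
      obtain ⟨l, hil, hjl⟩ := third i j
      apply hP i j l hj hil hjl
      rw [SixPts.det3, h0]; simp
    · intro i j hij t ht
      obtain ⟨l, hil, hjl⟩ := third i j
      apply hP i j l hij hil hjl
      rw [SixPts.det3, ← ht]
      simp only [Pi.smul_apply, smul_eq_mul]; ring
    · intro i j l hij hil hjl h0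
      exact hP i j l hij hil hjl ((SixPts.collinear_iff _ _ _).1 h0)
    · rintro ⟨Q, hQ, hQ0, hQP⟩
      obtain ⟨c, rfl⟩ := SixPts.exists_qp hQ
      refine hc c ?_ fun i => by rw [← SixPts.eval_qp]; exact hQP i
      rintro rfl
      exact hQ0 (by simp [SixPts.qp])
end

section
/- Let P_1, P_2, P_3 ∈ C(𝔽_q) be rational points on a smooth conic C over 𝔽_q, and let P_4, P_5 be the two points of a closed point of degree 2 on C. Let 𝔏 be the union of the line through P_4, P_5 and the three lines through pairs of P_1, P_2, P_3, and let 𝔠 = 𝔏 ∪ C. Then #𝔠(𝔽_q) = 5q − 4, and hence ℙ²(𝔽_q) ∖ 𝔠 has (q−2)² + 1 > 0 points. -/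
namespace ConicAux
open MvPolynomial

/-- Ternary quadratic form with coefficients `m`. -/
def qf {L : Type*} [Field L] (m : Fin 6 → L) (v : Fin 3 → L) : L :=
  m 0 * v 0 ^ 2 + m 1 * v 1 ^ 2 + m 2 * v 2 ^ 2 + m 3 * (v 0 * v 1) + m 4 * (v 0 * v 2)
    + m 5 * (v 1 * v 2)

/-- Polar form of `qf`. -/
def bf {L : Type*} [Field L] (m : Fin 6 → L) (u v : Fin 3 → L) : L :=
  m 0 * (2 * u 0 * v 0) + m 1 * (2 * u 1 * v 1) + m 2 * (2 * u 2 * v 2)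
    + m 3 * (u 0 * v 1 + u 1 * v 0) + m 4 * (u 0 * v 2 + u 2 * v 0)
    + m 5 * (u 1 * v 2 + u 2 * v 1)

/-- The polynomial with coefficients `m`. -/
noncomputable def qp {F : Type*} [Field F] (m : Fin 6 → F) : MvPolynomial (Fin 3) F :=
  C (m 0) * X 0 ^ 2 + C (m 1) * X 1 ^ 2 + C (m 2) * X 2 ^ 2 + C (m 3) * (X 0 * X 1)
    + C (m 4) * (X 0 * X 2) + C (m 5) * (X 1 * X 2)

theorem qp_add {F : Type*} [Field F] (m n : Fin 6 → F) : qp m + qp n = qp (m + n) := by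
  simp only [qp, Pi.add_apply, C_add]; ring

theorem exists_qp_monomial {F : Type*} [Field F] (d : Fin 3 →₀ ℕ) (c : F)
    (hd : d 0 + d 1 + d 2 = 2) : ∃ m : Fin 6 → F, monomial d c = qp m := by
  have key : monomial d c = C c * (X 0 ^ d 0 * X 1 ^ d 1 * X 2 ^ d 2) := by
    rw [monomial_eq, Finsupp.prod_fintype _ _ (by simp), Fin.prod_univ_three]
  rw [key]
  have h0 : d 0 ≤ 2 := by omega
  have h1 : d 1 ≤ 2 := by omega
  generalize d 0 = a at *
  generalize d 1 = b at *
  generalize d 2 = e at *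
  have he : e = 2 - a - b := by omega
  subst he
  interval_cases a <;> interval_cases b <;> simp at hd
  · exact ⟨![0,0,c,0,0,0], by simp [qp]⟩
  · exact ⟨![0,0,0,0,0,c], by simp [qp]⟩
  · exact ⟨![0,c,0,0,0,0], by simp [qp]⟩
  · exact ⟨![0,0,0,0,c,0], by simp [qp]⟩
  · exact ⟨![0,0,0,c,0,0], by simp [qp]⟩
  · exact ⟨![c,0,0,0,0,0], by simp [qp]⟩

theorem exists_qp {F : Type*} [Field F] (Q : MvPolynomial (Fin 3) F) (hQ : Q.IsHomogeneous 2) :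
    ∃ m : Fin 6 → F, Q = qp m := by
  have hs : ∀ s : Finset (Fin 3 →₀ ℕ), s ⊆ Q.support →
      ∃ m : Fin 6 → F, ∑ d ∈ s, monomial d (coeff d Q) = qp m := by
    intro s
    induction s using Finset.induction_on with
    | empty => exact fun _ => ⟨0, by simp [qp]⟩
    | insert d s hd ih =>
      intro hss
      obtain ⟨n, hn⟩ := ih (fun x hx => hss (Finset.mem_insert_of_mem hx))
      have hdm := hss (Finset.mem_insert_self d s)
      have hdeg : d 0 + d 1 + d 2 = 2 := by
        have := hQ (mem_support_iff.1 hdm)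
        rw [Finsupp.weight_apply, Finsupp.sum_fintype _ _ (by simp), Fin.sum_univ_three] at this
        simpa using this
      obtain ⟨m, hm⟩ := exists_qp_monomial d (coeff d Q) hdeg
      exact ⟨m + n, by rw [Finset.sum_insert hd, hn, hm, qp_add]⟩
  obtain ⟨m, hm⟩ := hs _ subset_rfl
  exact ⟨m, by rw [← hm]; exact Q.as_sum⟩

theorem aeval_qp {F L : Type*} [Field F] [Field L] [Algebra F L] (m : Fin 6 → F)
    (v : Fin 3 → L) : aeval v (qp m) = qf (fun i => algebraMap F L (m i)) v := by
  simp [qp, qf]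

theorem pderiv_qp {F L : Type*} [Field F] [Field L] [Algebra F L] (m : Fin 6 → F)
    (v : Fin 3 → L) (i : Fin 3) : aeval v (pderiv i (qp m)) =
      bf (fun i => algebraMap F L (m i)) v (Pi.single i 1) := by
  fin_cases i <;> simp [qp, bf, pderiv_X, Derivation.leibniz, Derivation.leibniz_pow]

theorem smooth_alg {F L : Type*} [Field F] [Field L] [Algebra F L] [Algebra.IsAlgebraic F L]
    (m : Fin 6 → F) (hs : SmoothPlaneCurve (qp m)) (v : Fin 3 → L) (hv : v ≠ 0)
    (h : qf (fun i => algebraMap F L (m i)) v = 0) :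
    ∃ w, bf (fun i => algebraMap F L (m i)) v w ≠ 0 := by
  let φ : L →ₐ[F] AlgebraicClosure F := IsAlgClosed.lift
  have hv' : (fun i => φ (v i)) ≠ 0 := by
    intro hz
    apply hv
    funext i
    have := congrFun hz i
    simpa using this
  obtain ⟨i, hi⟩ := hs (fun i => φ (v i)) hv' (by
    rw [← aeval_qp] at h
    have h2 := congrArg φ h
    rw [map_zero, ← AlgHom.comp_apply, comp_aeval] at h2
    exact h2)
  refine ⟨Pi.single i 1, ?_⟩
  rw [← pderiv_qp]
  intro h3
  apply hi
  have h2 := congrArg φ h3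
  rw [map_zero, ← AlgHom.comp_apply, comp_aeval] at h2
  exact h2

theorem indep {L : Type*} [Field L] (u v : Fin 3 → L) (hu : u ≠ 0) (h : ∀ c : L, c • u ≠ v)
    (a b : L) (hab : a • u + b • v = 0) : a = 0 ∧ b = 0 := by
  by_cases hb : b = 0
  · subst hb
    simp only [zero_smul, add_zero, smul_eq_zero] at hab
    exact ⟨hab.resolve_right hu, rfl⟩
  · exfalso
    apply h (-(b⁻¹ * a))
    have : b • v = -(a • u) := by rw [eq_neg_iff_add_eq_zero, add_comm]; exact hab
    rw [neg_smul, mul_smul, ← smul_neg, ← this, smul_smul, inv_mul_cancel₀ hb, one_smul]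

/-- Determinant as explicit dependency. -/
theorem dep_of_det {L : Type*} [Field L] (w u v : Fin 3 → L)
    (hi : ∀ a b : L, a • u + b • v = 0 → a = 0 ∧ b = 0)
    (h : (Matrix.of ![w, u, v]).det = 0) : ∃ s t : L, w = s • u + t • v := by
  obtain ⟨c, hc, hcz⟩ := Matrix.exists_vecMul_eq_zero_iff.2 h
  have hz : c 0 • w + c 1 • u + c 2 • v = 0 := by
    funext i
    have := congrFun hcz i
    simpa [Matrix.vecMul, dotProduct, Fin.sum_univ_three] using this
  by_cases h0 : c 0 = 0
  · exfalso
    rw [h0, zero_smul, zero_add] at hz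
    obtain ⟨h1, h2⟩ := hi _ _ hz
    apply hc
    funext i
    fin_cases i <;> simp [h0, h1, h2]
  · refine ⟨-((c 0)⁻¹ * c 1), -((c 0)⁻¹ * c 2), ?_⟩
    funext i
    have := congrFun hz i
    simp at this ⊢
    field_simp
    linear_combination this

theorem qf_comb {L : Type*} [Field L] (m : Fin 6 → L) (u v : Fin 3 → L) (s t : L) :
    qf m (s • u + t • v) = s ^ 2 * qf m u + t ^ 2 * qf m v + s * t * bf m u v := by
  simp [qf, bf]; ring

theorem qf_comb3 {L : Type*} [Field L] (m : Fin 6 → L) (u v w : Fin 3 → L) (s t r : L) :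
    qf m (s • u + t • v + r • w) = s ^ 2 * qf m u + t ^ 2 * qf m v + r ^ 2 * qf m w
      + s * t * bf m u v + s * r * bf m u w + t * r * bf m v w := by
  simp [qf, bf]; ring

theorem bf_comb {L : Type*} [Field L] (m : Fin 6 → L) (u v w : Fin 3 → L) (s t : L) :
    bf m (s • u + t • v) w = s * bf m u w + t * bf m v w := by
  simp [bf]; ring

theorem bf_symm {L : Type*} [Field L] (m : Fin 6 → L) (u v : Fin 3 → L) :
    bf m u v = bf m v u := by
  simp [bf]; ring

theorem bf_self {L : Type*} [Field L] (m : Fin 6 → L) (u : Fin 3 → L) :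
    bf m u u = 2 * qf m u := by
  simp [bf, qf]; ring

theorem comb_of_det {L : Type*} [Field L] (x u v w : Fin 3 → L)
    (h : (Matrix.of ![u, v, w]).det ≠ 0) : ∃ a b c : L, x = a • u + b • v + c • w := by
  refine ⟨(Matrix.of ![x, v, w]).det / (Matrix.of ![u, v, w]).det,
    (Matrix.of ![u, x, w]).det / (Matrix.of ![u, v, w]).det,
    (Matrix.of ![u, v, x]).det / (Matrix.of ![u, v, w]).det, ?_⟩
  funext i
  simp only [Pi.add_apply, Pi.smul_apply, smul_eq_mul]
  field_simp
  fin_cases i <;> simp [Matrix.det_fin_three] <;> ring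

theorem det_rot {L : Type*} [Field L] (u v w : Fin 3 → L) :
    (Matrix.of ![w, u, v]).det = (Matrix.of ![u, v, w]).det := by
  simp [Matrix.det_fin_three]; ring

theorem bf_ne {L : Type*} [Field L] (m : Fin 6 → L)
    (hs : ∀ v, v ≠ 0 → qf m v = 0 → ∃ w, bf m v w ≠ 0) (u v : Fin 3 → L) (hu : u ≠ 0)
    (h : ∀ c : L, c • u ≠ v) (hqu : qf m u = 0) (hqv : qf m v = 0) : bf m u v ≠ 0 := by
  intro hb
  obtain ⟨r, hr⟩ := hs u hu hqu
  have hi := indep u v hu h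
  have hd : (Matrix.of ![u, v, r]).det ≠ 0 := by
    rw [← det_rot]
    intro hd
    obtain ⟨s, t, hst⟩ := dep_of_det _ _ _ hi hd
    apply hr
    rw [bf_symm, hst, bf_comb, bf_symm m v, hb, bf_self, hqu]; ring
  have hv0 : (bf m v r) • u + (-(bf m u r)) • v ≠ 0 := by
    intro hz
    exact hr (neg_eq_zero.1 (hi _ _ hz).2)
  obtain ⟨w, hw⟩ := hs _ hv0 (by rw [qf_comb, hqu, hqv, hb]; ring)
  apply hw
  obtain ⟨a, b, c, rfl⟩ := comb_of_det w u v r hd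
  have e : ∀ z, bf m z (a • u + b • v + c • r) = a * bf m z u + b * bf m z v + c * bf m z r := by
    intro z
    simp [bf]; ring
  rw [e, bf_comb, bf_comb, bf_comb, bf_self, bf_self, bf_symm m v u, hb, hqu, hqv]; ring

open Classical in
theorem card_line {F : Type*} [Field F] [Fintype F] (α β : F) (ha : α ≠ 0) (hb : β ≠ 0) :
    (Finset.univ.filter (fun p : F × F => p.1 ≠ 0 ∧ p.2 ≠ 0 ∧ α * p.1 + β * p.2 + 1 = 0)).card
      = Fintype.card F - 2 := by
  have : (Finset.univ.filter (fun p : F × F => p.1 ≠ 0 ∧ p.2 ≠ 0 ∧ α * p.1 + β * p.2 + 1 = 0))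
      = ((Finset.univ \ {0, -(1 / α)} : Finset F)).image (fun x => (x, -(α * x + 1) / β)) := by
    ext ⟨x, y⟩
    simp only [Finset.mem_filter, Finset.mem_univ, true_and, Finset.mem_image, Finset.mem_sdiff,
      Finset.mem_insert, Finset.mem_singleton, not_or, Prod.mk.injEq]
    constructor
    · rintro ⟨hx, hy, h⟩
      refine ⟨x, ⟨hx, ?_⟩, rfl, ?_⟩
      · rintro rfl
        apply hy
        field_simp at h
        have : β * y = 0 := by linear_combination h
        exact (mul_eq_zero.1 this).resolve_left hb
      · field_simp
        linear_combination -h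
    · rintro ⟨x', ⟨hx, hx2⟩, rfl, rfl⟩
      refine ⟨hx, ?_, ?_⟩
      · intro h
        rw [div_eq_zero_iff] at h
        apply hx2
        have := h.resolve_right hb
        field_simp
        linear_combination -this
      · field_simp
        ring
  rw [this, Finset.card_image_of_injective, Finset.card_sdiff_of_subset (by simp),
    Finset.card_pair, Finset.card_univ]
  · intro h
    apply ha
    simpa using h.symm
  · intro x y h
    exact (Prod.mk.inj h).1

open Classical in
theorem card_conic {F : Type*} [Field F] [Fintype F] (a b c : F) (ha : a ≠ 0) (hb : b ≠ 0)
    (hc : c ≠ 0) :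
    (Finset.univ.filter (fun p : F × F => p.1 ≠ 0 ∧ p.2 ≠ 0 ∧
      a * (p.1 * p.2) + b * p.1 + c * p.2 = 0)).card = Fintype.card F - 2 := by
  rw [← card_line (c / a) (b / a) (div_ne_zero hc ha) (div_ne_zero hb ha)]
  refine Finset.card_bij' (fun p _ => (p.1⁻¹, p.2⁻¹)) (fun p _ => (p.1⁻¹, p.2⁻¹)) ?_ ?_ ?_ ?_
  · rintro ⟨x, y⟩ h
    simp only [Finset.mem_filter, Finset.mem_univ, true_and] at h ⊢
    obtain ⟨hx, hy, h⟩ := h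
    refine ⟨inv_ne_zero hx, inv_ne_zero hy, ?_⟩
    field_simp
    linear_combination h
  · rintro ⟨x, y⟩ h
    simp only [Finset.mem_filter, Finset.mem_univ, true_and] at h ⊢
    obtain ⟨hx, hy, h⟩ := h
    refine ⟨inv_ne_zero hx, inv_ne_zero hy, ?_⟩
    field_simp at h ⊢
    linear_combination h
  · rintro ⟨x, y⟩ h; simp
  · rintro ⟨x, y⟩ h; simp

open Classical in
theorem card_good {F : Type*} [Field F] [Fintype F] (a b c α β : F) (ha : a ≠ 0) (hb : b ≠ 0)
    (hc : c ≠ 0) (hα : α ≠ 0) (hβ : β ≠ 0)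
    (hdisj : ∀ x y : F, a * (x * y) + b * x + c * y = 0 → α * x + β * y + 1 ≠ 0) :
    (Finset.univ.filter (fun p : F × F => p.1 ≠ 0 ∧ p.2 ≠ 0 ∧
      a * (p.1 * p.2) + b * p.1 + c * p.2 ≠ 0 ∧ α * p.1 + β * p.2 + 1 ≠ 0)).card
      = (Fintype.card F - 2) ^ 2 + 1 := by
  set G := (Finset.univ.filter (fun p : F × F => p.1 ≠ 0 ∧ p.2 ≠ 0 ∧
      a * (p.1 * p.2) + b * p.1 + c * p.2 ≠ 0 ∧ α * p.1 + β * p.2 + 1 ≠ 0)) with hG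
  set A := (Finset.univ.filter (fun p : F × F => p.1 ≠ 0 ∧ p.2 ≠ 0 ∧
      a * (p.1 * p.2) + b * p.1 + c * p.2 = 0)) with hA
  set B := (Finset.univ.filter (fun p : F × F => p.1 ≠ 0 ∧ p.2 ≠ 0 ∧
      α * p.1 + β * p.2 + 1 = 0)) with hB
  have hAB : Disjoint A B := by
    rw [Finset.disjoint_left]
    intro p hp hq
    simp only [hA, hB, Finset.mem_filter] at hp hq
    exact hdisj _ _ hp.2.2.2 hq.2.2.2
  have hGAB : Disjoint G (A ∪ B) := by
    rw [Finset.disjoint_left]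
    intro p hp hq
    simp only [hG, hA, hB, Finset.mem_filter, Finset.mem_union] at hp hq
    tauto
  have hU : G ∪ (A ∪ B) = ((Finset.univ.erase 0 : Finset F) ×ˢ (Finset.univ.erase 0 : Finset F)) := by
    ext p
    simp only [hG, hA, hB, Finset.mem_filter, Finset.mem_union, Finset.mem_product,
      Finset.mem_erase, Finset.mem_univ, true_and, and_true]
    tauto
  have hcard := congrArg Finset.card hU
  rw [Finset.card_union_of_disjoint hGAB, Finset.card_union_of_disjoint hAB, Finset.card_product,
    card_conic a b c ha hb hc, card_line α β hα hβ, Finset.card_erase_of_mem (Finset.mem_univ _),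
    Finset.card_univ] at hcard
  have hq : 1 < Fintype.card F := Fintype.one_lt_card
  obtain ⟨n, hn⟩ := Nat.exists_eq_add_of_le hq
  rw [hn] at hcard ⊢
  have e1 : Nat.succ 1 + n - 2 = n := by omega
  have e2 : Nat.succ 1 + n - 1 = n + 1 := by omega
  rw [e1, e2] at hcard
  rw [e1]
  nlinarith


theorem exists_algebraMap {F K : Type*} [Field F] [Fintype F] [Field K] [Algebra F K]
    (x : K) (hx : x ^ Fintype.card F = x) : ∃ a : F, algebraMap F K a = x := by
  classical
  have h1 : 1 < Fintype.card F := Fintype.one_lt_card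
  have hne := FiniteField.X_pow_card_sub_X_ne_zero K h1
  have hd := FiniteField.X_pow_card_sub_X_natDegree_eq K h1
  set p : Polynomial K := Polynomial.X ^ Fintype.card F - Polynomial.X with hp
  have hsub : Finset.univ.image (algebraMap F K) ⊆ p.roots.toFinset := by
    intro y hy
    simp only [Finset.mem_image, Finset.mem_univ, true_and] at hy
    obtain ⟨a, rfl⟩ := hy
    rw [Multiset.mem_toFinset, Polynomial.mem_roots hne]
    simp [hp, ← map_pow, FiniteField.pow_card]
  have heq := Finset.eq_of_subset_of_card_le hsub (by
    rw [Finset.card_image_of_injective _ (algebraMap F K).injective, Finset.card_univ, ← hd]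
    exact (Multiset.toFinset_card_le _).trans (Polynomial.card_roots' _))
  have hxm : x ∈ p.roots.toFinset := by
    rw [Multiset.mem_toFinset, Polynomial.mem_roots hne]
    simp [hp, hx]
  rw [← heq] at hxm
  simpa using hxm

/-- The functional cutting out the line through a point and its Frobenius conjugate. -/
noncomputable def lam {F K : Type*} [Field F] [Fintype F] [Field K] [Algebra F K]
    (P₄ : Fin 3 → K) (v : Fin 3 → F) : K :=
  (Matrix.of ![(fun j => algebraMap F K (v j)), P₄, (fun j => P₄ j ^ Fintype.card F)]).det

theorem lam_comb {F K : Type*} [Field F] [Fintype F] [Field K] [Algebra F K]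
    (P₄ : Fin 3 → K) (u v w : Fin 3 → F) (a b c : F) :
    lam P₄ (a • u + b • v + c • w) = algebraMap F K a * lam P₄ u + algebraMap F K b * lam P₄ v
      + algebraMap F K c * lam P₄ w := by
  simp [lam, Matrix.det_fin_three]; ring

theorem lam_smul {F K : Type*} [Field F] [Fintype F] [Field K] [Algebra F K]
    (P₄ : Fin 3 → K) (u : Fin 3 → F) (a : F) :
    lam P₄ (a • u) = algebraMap F K a * lam P₄ u := by
  simp [lam, Matrix.det_fin_three]; ring

theorem lam_frob {F K : Type*} [Field F] [Fintype F] [Field K] [Fintype K] [Algebra F K]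
    (hK : Fintype.card K = (Fintype.card F)^2)
    (P₄ : Fin 3 → K) (v : Fin 3 → F) : lam P₄ v ^ Fintype.card F = - lam P₄ v := by
  have e : ∀ x : K, x ^ Fintype.card F = FiniteField.frobeniusAlgHom F K x := by
    intro x; simp
  have e2 : ∀ x : K, FiniteField.frobeniusAlgHom F K (FiniteField.frobeniusAlgHom F K x) = x := by
    intro x
    rw [← e, ← e, ← pow_mul, ← sq, ← hK, FiniteField.pow_card]
  simp only [lam, e, Matrix.det_fin_three]
  simp [-FiniteField.frobeniusAlgHom_apply, e2]
  ring

theorem qf_map {F K : Type*} [Field F] [Field K] [Algebra F K] (m : Fin 6 → F) (v : Fin 3 → F) :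
    qf (fun i => algebraMap F K (m i)) (fun j => algebraMap F K (v j))
      = algebraMap F K (qf m v) := by
  simp [qf]

theorem lam_ne {F K : Type*} [Field F] [Fintype F] [Field K] [Fintype K] [Algebra F K]
    (hK : Fintype.card K = (Fintype.card F)^2) (m : Fin 6 → F)
    (hs : ∀ v : Fin 3 → K, v ≠ 0 → qf (fun i => algebraMap F K (m i)) v = 0 →
      ∃ w, bf (fun i => algebraMap F K (m i)) v w ≠ 0)
    (P₄ : Fin 3 → K) (hP₄0 : P₄ ≠ 0) (hP₄C : qf (fun i => algebraMap F K (m i)) P₄ = 0)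
    (hdeg2 : ∀ c : K, c • P₄ ≠ fun j => P₄ j ^ Fintype.card F)
    (v : Fin 3 → F) (hv : v ≠ 0) (hqv : qf m v = 0) : lam P₄ v ≠ 0 := by
  intro hl
  have e : ∀ x : K, x ^ Fintype.card F = FiniteField.frobeniusAlgHom F K x := by
    intro x; simp
  have hq5 : qf (fun i => algebraMap F K (m i)) (fun j => P₄ j ^ Fintype.card F) = 0 := by
    have := congrArg (FiniteField.frobeniusAlgHom F K) hP₄C
    rw [map_zero] at this
    rw [← this]
    simp only [e, qf, map_add, map_mul, map_pow, AlgHom.commutes]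
  have hb := bf_ne _ hs P₄ _ hP₄0 hdeg2 hP₄C hq5
  obtain ⟨s, t, hst⟩ := dep_of_det _ _ _ (indep _ _ hP₄0 hdeg2) hl
  have hq := qf_map (K := K) m v
  rw [hqv, map_zero, hst, qf_comb, hP₄C, hq5] at hq
  have hst0 : s * t = 0 := by
    have : s * t * bf (fun i => algebraMap F K (m i)) P₄ (fun j => P₄ j ^ Fintype.card F) = 0 := by
      linear_combination hq
    exact (mul_eq_zero.1 this).resolve_right hb
  have hvK : (fun j => algebraMap F K (v j)) ≠ 0 := by
    intro hz
    apply hv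
    funext i
    have := congrFun hz i
    simpa using this
  have hvf : ∀ j, (algebraMap F K (v j)) ^ Fintype.card F = algebraMap F K (v j) := by
    intro j
    rw [← map_pow, FiniteField.pow_card]
  rcases mul_eq_zero.1 hst0 with h | h
  · subst h
    have ht : t ≠ 0 := by
      rintro rfl
      apply hvK
      rw [hst]; simp
    have h5 : ∀ j, algebraMap F K (v j) = t * P₄ j ^ Fintype.card F := by
      intro j
      have := congrFun hst j
      simpa using this
    have h4 : ∀ j, algebraMap F K (v j) = t ^ Fintype.card F * P₄ j := by
      intro j
      rw [← hvf, h5, mul_pow, ← pow_mul, ← sq, ← hK, FiniteField.pow_card]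
    apply hdeg2 (t⁻¹ * t ^ Fintype.card F)
    funext j
    have := (h5 j).symm.trans (h4 j)
    simp only [Pi.smul_apply, smul_eq_mul]
    rw [mul_assoc, ← this, ← mul_assoc, inv_mul_cancel₀ ht, one_mul]
  · subst h
    have ht : s ≠ 0 := by
      rintro rfl
      apply hvK
      rw [hst]; simp
    have h5 : ∀ j, algebraMap F K (v j) = s * P₄ j := by
      intro j
      have := congrFun hst j
      simpa using this
    have h4 : ∀ j, algebraMap F K (v j) = s ^ Fintype.card F * P₄ j ^ Fintype.card F := by
      intro j
      rw [← hvf, h5, mul_pow]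
    have hsq := pow_ne_zero (Fintype.card F) ht
    apply hdeg2 ((s ^ Fintype.card F)⁻¹ * s)
    funext j
    have := (h5 j).symm.trans (h4 j)
    simp only [Pi.smul_apply, smul_eq_mul]
    rw [mul_assoc, this, ← mul_assoc, inv_mul_cancel₀ hsq, one_mul]

theorem det_smul_row {L : Type*} [Field L] (a : L) (u v w : Fin 3 → L) :
    (Matrix.of ![a • u, v, w]).det = a * (Matrix.of ![u, v, w]).det := by
  simp [Matrix.det_fin_three]; ring

theorem qf_smul {L : Type*} [Field L] (m : Fin 6 → L) (a : L) (u : Fin 3 → L) :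
    qf m (a • u) = a ^ 2 * qf m u := by
  simp [qf]; ring

/-- Triangle condition in coordinates. -/
theorem tri_iff {F : Type*} [Field F] (P : Fin 3 → (Fin 3 → F))
    (hD : (Matrix.of ![P 0, P 1, P 2]).det ≠ 0) (x y z : F) :
    (∃ i j : Fin 3, i ≠ j ∧ (Matrix.of ![x • P 0 + y • P 1 + z • P 2, P i, P j]).det = 0) ↔
      x = 0 ∨ y = 0 ∨ z = 0 := by
  set D := (Matrix.of ![P 0, P 1, P 2]).det with hDd
  have d01 : (Matrix.of ![x • P 0 + y • P 1 + z • P 2, P 0, P 1]).det = z * D := by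
    simp [hDd, Matrix.det_fin_three]; ring
  have d10 : (Matrix.of ![x • P 0 + y • P 1 + z • P 2, P 1, P 0]).det = -(z * D) := by
    simp [hDd, Matrix.det_fin_three]; ring
  have d02 : (Matrix.of ![x • P 0 + y • P 1 + z • P 2, P 0, P 2]).det = -(y * D) := by
    simp [hDd, Matrix.det_fin_three]; ring
  have d20 : (Matrix.of ![x • P 0 + y • P 1 + z • P 2, P 2, P 0]).det = y * D := by
    simp [hDd, Matrix.det_fin_three]; ring
  have d12 : (Matrix.of ![x • P 0 + y • P 1 + z • P 2, P 1, P 2]).det = x * D := by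
    simp [hDd, Matrix.det_fin_three]; ring
  have d21 : (Matrix.of ![x • P 0 + y • P 1 + z • P 2, P 2, P 1]).det = -(x * D) := by
    simp [hDd, Matrix.det_fin_three]; ring
  constructor
  · rintro ⟨i, j, hij, h⟩
    fin_cases i <;> fin_cases j <;>
      simp only [Fin.zero_eta, Fin.mk_one, Fin.reduceFinMk, ne_eq, not_true_eq_false] at hij h <;>
      simp only [d01, d10, d02, d20, d12, d21, neg_eq_zero, mul_eq_zero, hD, or_false] at h <;>
      tauto
  · rintro (h | h | h)
    · exact ⟨1, 2, by decide, by rw [d12, h, zero_mul]⟩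
    · exact ⟨2, 0, by decide, by rw [d20, h, zero_mul]⟩
    · exact ⟨0, 1, by decide, by rw [d01, h, zero_mul]⟩

/-- The complement count, via torus coordinates. -/
theorem card_compl {F : Type*} [Field F] [Fintype F] (Good : (Fin 3 → F) → Prop)
    (P : Fin 3 → (Fin 3 → F)) (hD : (Matrix.of ![P 0, P 1, P 2]).det ≠ 0)
    (hsm : ∀ (a : F) v, a ≠ 0 → (Good (a • v) ↔ Good v))
    (a b c α β : F) (ha : a ≠ 0) (hb : b ≠ 0)
    (hc : c ≠ 0) (hα : α ≠ 0) (hβ : β ≠ 0)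
    (hdisj : ∀ x y : F, a * (x * y) + b * x + c * y = 0 → α * x + β * y + 1 ≠ 0)
    (hz : ∀ x y z : F, Good (x • P 0 + y • P 1 + z • P 2) → z ≠ 0)
    (h1 : ∀ x y : F, Good (x • P 0 + y • P 1 + (1 : F) • P 2) ↔ x ≠ 0 ∧ y ≠ 0 ∧
      a * (x * y) + b * x + c * y ≠ 0 ∧ α * x + β * y + 1 ≠ 0) :
    Nat.card {p : Projectivization F (Fin 3 → F) // Good p.rep}
      = (Fintype.card F - 2) ^ 2 + 1 := by
  classical
  have hind : ∀ x y z : F, x • P 0 + y • P 1 + z • P 2 = 0 → x = 0 ∧ y = 0 ∧ z = 0 := by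
    intro x y z h
    have hx := (tri_iff P hD x y z)
    have k1 : (Matrix.of ![x • P 0 + y • P 1 + z • P 2, P 1, P 2]).det
        = x * (Matrix.of ![P 0, P 1, P 2]).det := by
      simp [Matrix.det_fin_three]; ring
    have k2 : (Matrix.of ![P 0, x • P 0 + y • P 1 + z • P 2, P 2]).det
        = y * (Matrix.of ![P 0, P 1, P 2]).det := by
      simp [Matrix.det_fin_three]; ring
    have k3 : (Matrix.of ![P 0, P 1, x • P 0 + y • P 1 + z • P 2]).det
        = z * (Matrix.of ![P 0, P 1, P 2]).det := by
      simp [Matrix.det_fin_three]; ring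
    rw [h] at k1 k2 k3
    simp [Matrix.det_fin_three] at k1 k2 k3 hD
    tauto
  have hne : ∀ x y : F, x • P 0 + y • P 1 + (1 : F) • P 2 ≠ 0 := fun x y h =>
    one_ne_zero (hind x y 1 h).2.2
  have hmk : ∀ v (hv : v ≠ 0), Good (Projectivization.mk F v hv).rep ↔ Good v := by
    intro v hv
    obtain ⟨u, hu⟩ := Projectivization.exists_smul_eq_mk_rep F v hv
    rw [← hu]
    exact hsm u v u.ne_zero
  rw [← card_good a b c α β ha hb hc hα hβ hdisj, ← Fintype.card_coe, ← Nat.card_eq_fintype_card]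
  symm
  let f : {p // p ∈ (Finset.univ.filter (fun p : F × F => p.1 ≠ 0 ∧ p.2 ≠ 0 ∧
      a * (p.1 * p.2) + b * p.1 + c * p.2 ≠ 0 ∧ α * p.1 + β * p.2 + 1 ≠ 0))} →
      {p : Projectivization F (Fin 3 → F) // Good p.rep} := fun p =>
    ⟨Projectivization.mk F _ (hne p.1.1 p.1.2),
      (hmk _ _).2 ((h1 _ _).2 (Finset.mem_filter.1 p.2).2)⟩
  refine Nat.card_congr (Equiv.ofBijective f ⟨?_, ?_⟩)
  · rintro ⟨⟨x, y⟩, h⟩ ⟨⟨x', y'⟩, h'⟩ hf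
    have hf2 := congrArg Subtype.val hf
    simp only [f] at hf2
    rw [Projectivization.mk_eq_mk_iff'] at hf2
    obtain ⟨k, hk⟩ := hf2
    have h3 := hind (k * x' - x) (k * y' - y) (k - 1) (by
      have : (k * x' - x) • P 0 + (k * y' - y) • P 1 + (k - 1) • P 2 =
        k • (x' • P 0 + y' • P 1 + (1 : F) • P 2) - (x • P 0 + y • P 1 + (1 : F) • P 2) := by
        module
      rw [this, hk, sub_self])
    obtain ⟨e1, e2, e3⟩ := h3
    have hk1 : k = 1 := sub_eq_zero.1 e3
    subst hk1
    simp only [one_mul, sub_eq_zero] at e1 e2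
    subst e1 e2
    rfl
  · rintro ⟨p, hp⟩
    obtain ⟨x, y, z, hv⟩ := comb_of_det p.rep (P 0) (P 1) (P 2) hD
    have hz0 : z ≠ 0 := hz x y z (hv ▸ hp)
    have hv2 : p.rep = z • ((x / z) • P 0 + (y / z) • P 1 + (1 : F) • P 2) := by
      rw [hv, smul_add, smul_add, smul_smul, smul_smul, smul_smul, mul_div_cancel₀ _ hz0,
        mul_div_cancel₀ _ hz0, mul_one]
    have hg : Good ((x / z) • P 0 + (y / z) • P 1 + (1 : F) • P 2) := by
      rw [← hsm z _ hz0, ← hv2]; exact hp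
    refine ⟨⟨(x / z, y / z), Finset.mem_filter.2 ⟨Finset.mem_univ _, (h1 _ _).1 hg⟩⟩, ?_⟩
    apply Subtype.ext
    simp only [f]
    conv_rhs => rw [← p.mk_rep]
    rw [Projectivization.mk_eq_mk_iff']
    refine ⟨z⁻¹, ?_⟩
    rw [hv2, smul_smul, inv_mul_cancel₀ hz0, one_smul]

end ConicAux

/-- Let `C : Q = 0` be a smooth conic over `𝔽_q`, `P₁, P₂, P₃ ∈ C(𝔽_q)` rational points on
it, and `P₄, P₅ = P₄^Frob` the two (projectively distinct, Galois-conjugate) points of a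
closed point of degree `2` on `C`, with coordinates in `𝔽_{q²}`.  Let `𝔠` be the union of
`C`, the three lines through pairs of `P₁, P₂, P₃`, and the line through `P₄, P₅`.  Then
`#𝔠(𝔽_q) = 5q − 4`, and hence `ℙ²(𝔽_q) ∖ 𝔠` has `(q−2)² + 1 > 0` points. -/
theorem card_conic_line_configuration {F K : Type*} [Field F] [Fintype F]
    [Field K] [Fintype K] [Algebra F K]
    (hK : Fintype.card K = (Fintype.card F)^2)
    (Q : MvPolynomial (Fin 3) F) (hQ2 : Q.IsHomogeneous 2) (hQ0 : Q ≠ 0)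
    (hQs : SmoothPlaneCurve Q)
    (P : Fin 3 → (Fin 3 → F)) (h0 : ∀ i, P i ≠ 0)
    (hdist : ∀ i j, i ≠ j → ∀ c : F, c • P i ≠ P j)
    (hPC : ∀ i, MvPolynomial.eval (P i) Q = 0)
    (P₄ : Fin 3 → K) (hP₄0 : P₄ ≠ 0)
    (hP₄C : MvPolynomial.aeval P₄ Q = 0)
    -- `P₅ = P₄^Frob` is projectively distinct from `P₄`, i.e. `P₄` is not rational:
    (hdeg2 : ∀ c : K, c • P₄ ≠ fun j => P₄ j ^ Fintype.card F) :
    Nat.card {p : Projectivization F (Fin 3 → F) //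
        MvPolynomial.eval p.rep Q = 0 ∨
        (∃ i j : Fin 3, i ≠ j ∧ (Matrix.of ![p.rep, P i, P j]).det = 0) ∨
        (Matrix.of ![(fun j => algebraMap F K (p.rep j)), P₄,
          (fun j => P₄ j ^ Fintype.card F)]).det = 0}
      = 5 * Fintype.card F - 4 ∧
    Nat.card {p : Projectivization F (Fin 3 → F) //
        ¬ (MvPolynomial.eval p.rep Q = 0 ∨
        (∃ i j : Fin 3, i ≠ j ∧ (Matrix.of ![p.rep, P i, P j]).det = 0) ∨
        (Matrix.of ![(fun j => algebraMap F K (p.rep j)), P₄,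
          (fun j => P₄ j ^ Fintype.card F)]).det = 0)}
      = (Fintype.card F - 2)^2 + 1 ∧
    0 < (Fintype.card F - 2)^2 + 1 := by
  classical
  obtain ⟨m, rfl⟩ := ConicAux.exists_qp Q hQ2
  have hfin : Module.Finite F K := Module.Finite.of_finite
  have halg : Algebra.IsAlgebraic F K := inferInstance
  have hsF : ∀ v : Fin 3 → F, v ≠ 0 → ConicAux.qf m v = 0 → ∃ w, ConicAux.bf m v w ≠ 0 :=
    fun v => ConicAux.smooth_alg (L := F) m hQs v
  have hsK := ConicAux.smooth_alg (L := K) m hQs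
  have hev : ∀ v : Fin 3 → F, MvPolynomial.eval v (ConicAux.qp m) = ConicAux.qf m v := by
    intro v
    have := ConicAux.aeval_qp (L := F) m v
    rw [MvPolynomial.aeval_eq_eval] at this
    exact this
  simp only [hev] at hPC ⊢
  rw [ConicAux.aeval_qp] at hP₄C
  have hbb : ∀ i j, i ≠ j → ConicAux.bf m (P i) (P j) ≠ 0 := fun i j hij =>
    ConicAux.bf_ne m hsF _ _ (h0 i) (hdist i j hij) (hPC i) (hPC j)
  have hD : (Matrix.of ![P 0, P 1, P 2]).det ≠ 0 := by
    rw [← ConicAux.det_rot]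
    intro hd
    obtain ⟨s, t, hst⟩ := ConicAux.dep_of_det _ _ _
      (ConicAux.indep _ _ (h0 0) (hdist 0 1 (by decide))) hd
    have h2 := hPC 2
    rw [hst, ConicAux.qf_comb, hPC 0, hPC 1] at h2
    have h3 : s * t * ConicAux.bf m (P 0) (P 1) = 0 := by linear_combination h2
    rcases mul_eq_zero.1 ((mul_eq_zero.1 h3).resolve_right (hbb 0 1 (by decide))) with h | h
    · exact hdist 1 2 (by decide) t (by rw [hst, h]; simp)
    · exact hdist 0 2 (by decide) s (by rw [hst, h]; simp)
  have hl := ConicAux.lam_ne hK m hsK P₄ hP₄0 hP₄C hdeg2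
  have hlP : ∀ i, ConicAux.lam P₄ (P i) ≠ 0 := fun i => hl _ (h0 i) (hPC i)
  have hrat : ∀ i, ∃ a : F, algebraMap F K a * ConicAux.lam P₄ (P 2) = ConicAux.lam P₄ (P i) := by
    intro i
    obtain ⟨a, ha⟩ := ConicAux.exists_algebraMap (F := F)
      (ConicAux.lam P₄ (P i) / ConicAux.lam P₄ (P 2)) (by
        rw [div_pow, ConicAux.lam_frob hK, ConicAux.lam_frob hK, neg_div_neg_eq])
    exact ⟨a, by rw [ha, div_mul_cancel₀ _ (hlP 2)]⟩
  obtain ⟨α, hα⟩ := hrat 0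
  obtain ⟨β, hβ⟩ := hrat 1
  have hα0 : α ≠ 0 := by
    rintro rfl
    exact hlP 0 (by rw [← hα]; simp)
  have hβ0 : β ≠ 0 := by
    rintro rfl
    exact hlP 1 (by rw [← hβ]; simp)
  have hlam1 : ∀ x y : F, ConicAux.lam P₄ (x • P 0 + y • P 1 + (1 : F) • P 2) = 0 ↔
      α * x + β * y + 1 = 0 := by
    intro x y
    have e : ConicAux.lam P₄ (x • P 0 + y • P 1 + (1 : F) • P 2) =
        algebraMap F K (α * x + β * y + 1) * ConicAux.lam P₄ (P 2) := by
      rw [ConicAux.lam_comb, ← hα, ← hβ]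
      simp only [map_add, map_mul, map_one]
      ring
    rw [e, mul_eq_zero, or_iff_left (hlP 2), map_eq_zero]
  have hq1 : ∀ x y : F, ConicAux.qf m (x • P 0 + y • P 1 + (1 : F) • P 2) =
      ConicAux.bf m (P 0) (P 1) * (x * y) + ConicAux.bf m (P 0) (P 2) * x
        + ConicAux.bf m (P 1) (P 2) * y := by
    intro x y
    rw [ConicAux.qf_comb3, hPC 0, hPC 1, hPC 2]
    ring
  have hmain : Nat.card {p : Projectivization F (Fin 3 → F) //
        ¬ (ConicAux.qf m p.rep = 0 ∨
        (∃ i j : Fin 3, i ≠ j ∧ (Matrix.of ![p.rep, P i, P j]).det = 0) ∨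
        (Matrix.of ![(fun j => algebraMap F K (p.rep j)), P₄,
          (fun j => P₄ j ^ Fintype.card F)]).det = 0)}
      = (Fintype.card F - 2)^2 + 1 := by
    refine ConicAux.card_compl (fun v => ¬ (ConicAux.qf m v = 0 ∨
        (∃ i j : Fin 3, i ≠ j ∧ (Matrix.of ![v, P i, P j]).det = 0) ∨
        ConicAux.lam P₄ v = 0)) P hD ?_ (ConicAux.bf m (P 0) (P 1)) (ConicAux.bf m (P 0) (P 2))
        (ConicAux.bf m (P 1) (P 2)) α β (hbb _ _ (by decide)) (hbb _ _ (by decide))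
        (hbb _ _ (by decide)) hα0 hβ0 ?_ ?_ ?_
    · intro a v ha
      simp [ConicAux.qf_smul, ConicAux.det_smul_row, ConicAux.lam_smul, ha]
    · intro x y h
      rw [← hq1] at h
      rw [Ne, ← hlam1]
      refine hl _ ?_ h
      intro hz
      have h4 := (hlam1 x y)
      have := (ConicAux.tri_iff P hD x y 1)
      have k3 : (Matrix.of ![P 0, P 1, x • P 0 + y • P 1 + (1 : F) • P 2]).det
          = (Matrix.of ![P 0, P 1, P 2]).det := by
        simp [Matrix.det_fin_three]; ring
      apply hD
      rw [← k3, hz]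
      simp [Matrix.det_fin_three]
    · intro x y z h hz
      exact h (Or.inr (Or.inl ((ConicAux.tri_iff P hD x y z).2 (Or.inr (Or.inr hz)))))
    · intro x y
      simp only [ConicAux.tri_iff P hD x y 1, hlam1, hq1, one_ne_zero, or_false]
      tauto
  refine ⟨?_, hmain, Nat.succ_pos _⟩
  have htot : Nat.card (Projectivization F (Fin 3 → F)) =
      1 + Fintype.card F + Fintype.card F ^ 2 := by
    rw [Projectivization.card_of_finrank F (Fin 3 → F) (n := 3) (by simp)]
    simp [Finset.sum_range_succ, Nat.card_eq_fintype_card]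
  have hfinP : Finite (Projectivization F (Fin 3 → F)) :=
    (Projectivization.finite_iff_of_finite F (Fin 3 → F)).2 inferInstance
  have hsum := Nat.card_congr (Equiv.sumCompl (fun p : Projectivization F (Fin 3 → F) =>
        ConicAux.qf m p.rep = 0 ∨
        (∃ i j : Fin 3, i ≠ j ∧ (Matrix.of ![p.rep, P i, P j]).det = 0) ∨
        (Matrix.of ![(fun j => algebraMap F K (p.rep j)), P₄,
          (fun j => P₄ j ^ Fintype.card F)]).det = 0))
  rw [Nat.card_sum, hmain, htot] at hsum
  have hq : 1 < Fintype.card F := Fintype.one_lt_card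
  obtain ⟨n, hn⟩ := Nat.exists_eq_add_of_le hq
  rw [hn] at hsum ⊢
  have e1 : Nat.succ 1 + n - 2 = n := by omega
  have e2 : 5 * (Nat.succ 1 + n) - 4 = 5 * n + 6 := by omega
  rw [e1] at hsum
  rw [e2]
  nlinarith
end
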